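/- arXiv:1803.06101 — 2 statements merged into one kernel-verified Lean document; each statement's English description precedes it below -/
import Mathlib

section
/- Let γ_1 ≥ γ_2 ≥ ⋯ be a nonincreasing sequence of positive reals defining product weights γ_u = ∏_{j∈u} γ_j. Then for every δ ∈ (0, 1/2) there exists a constant C_δ > 0 such that for all dimensions d ≥ 1 and all integers N ≥ 1, D*_{N,γ}(H_{d,N}) ≤ (C_δ / N^{1/2−δ}) · max_{∅≠u⊆{1,…,d}} ∏_{j∈u} (j·γ_j). -/
open Finset Real

noncomputable section

/-- Radical inverse function in base `b`: if `n = ∑ nᵢ bⁱ` then `radInv b n = ∑ nᵢ b^{-i-1}`. -/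
def radInv (b n : ℕ) : ℝ := ∑' i : ℕ, (((n / b ^ i) % b : ℕ) : ℝ) / (b : ℝ) ^ (i + 1)

/-- `n`-th point of the `d`-dimensional Halton sequence; coordinate `j` (0-based)
uses the `(j+1)`-st prime (`Nat.nth Nat.Prime 0 = 2`). -/
def halton (d n : ℕ) : Fin d → ℝ := fun j => radInv (Nat.nth Nat.Prime j) n

open scoped Classical in
/-- Star discrepancy of the point set `P` of `N` points with coordinates indexed by `ι`:
`D*_N(P) = sup_{α ∈ [0,1]^ι} |#{n : P n ∈ [0,α)}/N − ∏ᵢ αᵢ|`. -/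
def starDisc {ι : Type} [Fintype ι] (N : ℕ) (P : Fin N → ι → ℝ) : ℝ :=
  sSup {t : ℝ | ∃ α : ι → ℝ, (∀ i, 0 ≤ α i ∧ α i ≤ 1) ∧
    t = |((Finset.univ.filter fun n : Fin N => ∀ i, 0 ≤ P n i ∧ P n i < α i).card : ℝ) / N
          - ∏ i, α i|}

/-- Star discrepancy of the projection of the first `N` points of the `d`-dimensional
Halton sequence onto the coordinates in `u`. -/
def haltonProjStarDisc (d N : ℕ) (u : Finset (Fin d)) : ℝ :=
  starDisc N fun n (i : u) => halton d n i.1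

/-- Weighted star discrepancy, for product weights built from `γ : ℕ → ℝ` (1-based:
coordinate `j : Fin d` carries weight `γ (j+1)`), of the first `N` points of the
`d`-dimensional Halton sequence:
`max_{∅ ≠ u ⊆ [d]} (∏_{j ∈ u} γ_j) · D*_N(H_{d,N}(u))`. -/
def wHaltonStarDisc (γ : ℕ → ℝ) (d N : ℕ) : ℝ :=
  sSup {t : ℝ | ∃ u : Finset (Fin d), u.Nonempty ∧
    t = (∏ j ∈ u, γ (j.1 + 1)) * haltonProjStarDisc d N u}

/-! ### The radical inverse and elementary intervals -/

lemma summable_radInv {b : ℕ} (hb : 2 ≤ b) (n : ℕ) :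
    Summable fun i : ℕ => (((n / b ^ i) % b : ℕ) : ℝ) / (b : ℝ) ^ (i + 1) := by
  refine summable_of_ne_finset_zero (s := Finset.range n) fun i hi => ?_
  have hlt : n < b ^ i :=
    (not_lt.mp (Finset.mem_range.not.mp hi)).trans_lt (Nat.lt_pow_self (by lia))
  simp [Nat.div_eq_of_lt hlt]

lemma radInv_nonneg (b n : ℕ) : 0 ≤ radInv b n :=
  tsum_nonneg fun _ => by positivity

lemma radInv_eq_mod_add_div {b : ℕ} (hb : 2 ≤ b) (n : ℕ) :
    radInv b n = ((n % b : ℕ) + radInv b (n / b)) / b := by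
  have hb0 : (b : ℝ) ≠ 0 := by positivity
  rw [radInv, (summable_radInv hb n).tsum_eq_zero_add, add_div]
  congr 1
  · simp
  · rw [radInv, ← tsum_div_const]
    refine tsum_congr fun i => ?_
    rw [Nat.div_div_eq_div_mul, ← pow_succ', pow_succ _ (i + 1), div_div]

lemma radInv_lt_one {b : ℕ} (hb : 2 ≤ b) (n : ℕ) : radInv b n < 1 := by
  induction n using Nat.strong_induction_on with
  | _ n ih =>
    rcases Nat.eq_zero_or_pos n with rfl | hn
    · simp [radInv]
    · have hlt := ih (n / b) (Nat.div_lt_self hn hb)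
      have hmod : ((n % b : ℕ) : ℝ) + 1 ≤ b := by exact_mod_cast Nat.mod_lt n (by lia)
      rw [radInv_eq_mod_add_div hb, div_lt_one (by positivity)]
      linarith

lemma modEq_mul_add_iff {b t : ℕ} (ht : t < b) (n m r : ℕ) :
    n ≡ b * r + t [MOD b * m] ↔ n % b = t ∧ n / b ≡ r [MOD m] := by
  constructor
  · intro h
    have hmod : n % b = t := by
      have := h.of_mul_right m
      rwa [Nat.ModEq, Nat.mul_add_mod, Nat.mod_eq_of_lt ht] at this
    refine ⟨hmod, ?_⟩
    rw [← Nat.div_add_mod n b, hmod] at h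
    exact (Nat.ModEq.add_right_cancel' t h).mul_left_cancel' (by lia)
  · rintro ⟨hmod, h⟩
    conv_lhs => rw [← Nat.div_add_mod n b, hmod]
    exact (h.mul_left' b).add_right t

/-- An elementary interval in base `b` is the image of exactly one residue class. -/
lemma exists_radInv_mem_elementary_iff {b : ℕ} (hb : 2 ≤ b) (k : ℕ) :
    ∀ a < b ^ k, ∃ r : ℕ, ∀ n : ℕ,
      ((a : ℝ) / (b : ℝ) ^ k ≤ radInv b n ∧ radInv b n < ((a : ℝ) + 1) / (b : ℝ) ^ k) ↔
        n ≡ r [MOD b ^ k] := by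
  have hb0 : (0 : ℝ) < b := by positivity
  induction k with
  | zero =>
    intro a ha
    obtain rfl : a = 0 := by simpa using ha
    exact ⟨0, fun n => by simpa [Nat.modEq_one] using ⟨radInv_nonneg b n, radInv_lt_one hb n⟩⟩
  | succ k ih =>
    intro a ha
    have hbk : (0 : ℝ) < (b : ℝ) ^ k := by positivity
    have ha' : a % b ^ k < b ^ k := Nat.mod_lt _ (by positivity)
    obtain ⟨r, hr⟩ := ih _ ha'
    have ht : a / b ^ k < b := Nat.div_lt_of_lt_mul (by rwa [← pow_succ])
    refine ⟨b * r + a / b ^ k, fun n => ?_⟩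
    have ha_eq : (a : ℝ) = (b : ℝ) ^ k * (a / b ^ k : ℕ) + (a % b ^ k : ℕ) := by
      exact_mod_cast (Nat.div_add_mod a (b ^ k)).symm
    rw [pow_succ' b, modEq_mul_add_iff ht, ← hr, radInv_eq_mod_add_div hb n, pow_succ' (b : ℝ),
      ← div_div, ← div_div, div_right_comm, div_right_comm (c := (b : ℝ) ^ k), div_le_div_iff_of_pos_right hb0,
      div_lt_div_iff_of_pos_right hb0]
    have h0 := radInv_nonneg b (n / b)
    have h1 := radInv_lt_one hb (n / b)
    have hlow : (a : ℝ) / (b : ℝ) ^ k = (a / b ^ k : ℕ) + (a % b ^ k : ℕ) / (b : ℝ) ^ k := by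
      conv_lhs => rw [ha_eq]
      field_simp
    have hupp : ((a : ℝ) + 1) / (b : ℝ) ^ k
        = (a / b ^ k : ℕ) + ((a % b ^ k : ℕ) + 1) / (b : ℝ) ^ k := by
      rw [add_div, hlow, add_div, add_assoc]
    have hfrac0 : 0 ≤ ((a % b ^ k : ℕ) : ℝ) / (b : ℝ) ^ k := by positivity
    have hfrac1 : (((a % b ^ k : ℕ) : ℝ) + 1) / (b : ℝ) ^ k ≤ 1 := by
      rw [div_le_one hbk]
      exact_mod_cast ha'
    rw [hlow, hupp]
    constructor
    · rintro ⟨hl, hu⟩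
      have hle : n % b ≤ a / b ^ k := by
        rw [← Nat.lt_add_one_iff]
        exact_mod_cast (by linarith : ((n % b : ℕ) : ℝ) < (a / b ^ k : ℕ) + 1)
      have hge : a / b ^ k ≤ n % b := by
        rw [← Nat.lt_add_one_iff]
        exact_mod_cast (by linarith : ((a / b ^ k : ℕ) : ℝ) < (n % b : ℕ) + 1)
      have heq := le_antisymm hle hge
      rw [heq] at hl hu
      exact ⟨heq, by linarith, by linarith⟩
    · rintro ⟨heq, hl, hu⟩
      rw [heq]
      exact ⟨by linarith, by linarith⟩

/-! ### The local discrepancy of boxes -/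

/-- A function whose increments over elementary intervals in base `b` are bounded by `E` grows at
most linearly in the number of digits. -/
lemma abs_le_of_elementary_increments {e : ℝ → ℝ} {b : ℕ} (hb : 2 ≤ b) {E : ℝ} (h0 : e 0 = 0)
    (hstep : ∀ k a : ℕ, a < b ^ k →
      |e (((a : ℝ) + 1) / (b : ℝ) ^ k) - e ((a : ℝ) / (b : ℝ) ^ k)| ≤ E) (k : ℕ) :
    ∀ m ≤ b ^ k, |e ((m : ℝ) / (b : ℝ) ^ k)| ≤ (k * (b - 1) + 1) * E := by
  have hE : 0 ≤ E := (abs_nonneg _).trans (hstep 0 0 (by simp))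
  induction k with
  | zero =>
    intro m hm
    have hm1 : m ≤ 1 := by simpa using hm
    have h1 := hstep 0 0 (by simp)
    interval_cases m <;> simp_all
  | succ k ih =>
    intro m hm
    have hq : m / b ≤ b ^ k := Nat.div_le_of_le_mul (by rwa [← pow_succ'])
    have key : ∀ t : ℕ, b * (m / b) + t ≤ b ^ (k + 1) →
        |e (((b * (m / b) + t : ℕ) : ℝ) / (b : ℝ) ^ (k + 1))|
          ≤ (k * (b - 1) + 1) * E + t * E := by
      intro t
      induction t with
      | zero =>
        intro _
        have hcancel : ((b * (m / b) + 0 : ℕ) : ℝ) / (b : ℝ) ^ (k + 1)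
            = ((m / b : ℕ) : ℝ) / (b : ℝ) ^ k := by
          have : (b : ℝ) ≠ 0 := by positivity
          rw [add_zero, Nat.cast_mul, pow_succ']
          field_simp
        rw [hcancel]
        simpa using ih _ hq
      | succ t iht =>
        intro ht
        have h1 := iht (by lia)
        have h2 := hstep (k + 1) (b * (m / b) + t) (by lia)
        have hcast : ((b * (m / b) + (t + 1) : ℕ) : ℝ) = ((b * (m / b) + t : ℕ) : ℝ) + 1 := by
          push_cast; ring
        rw [hcast]
        have h3 := abs_sub_abs_le_abs_sub
          (e ((((b * (m / b) + t : ℕ) : ℝ) + 1) / (b : ℝ) ^ (k + 1)))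
          (e (((b * (m / b) + t : ℕ) : ℝ) / (b : ℝ) ^ (k + 1)))
        push_cast at *
        linarith
    have hm' := key (m % b) (by rwa [Nat.div_add_mod])
    rw [Nat.div_add_mod] at hm'
    have hmod : ((m % b : ℕ) : ℝ) + 1 ≤ b := by exact_mod_cast Nat.mod_lt m (by lia)
    refine hm'.trans ?_
    have := mul_le_mul_of_nonneg_right (le_sub_iff_add_le.mpr hmod) hE
    push_cast
    linarith

open scoped Classical in
lemma abs_card_modEq_sub_le (N : ℕ) {M : ℕ} (hM : 0 < M) (r : ℕ) :
    |(((Finset.range N).filter (· ≡ r [MOD M])).card : ℝ) - N / M| ≤ 1 := by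
  have h := Nat.count_modEq_card (r := M) N hM r
  rw [Nat.count_eq_card_filter_range] at h
  have hM' : (0 : ℝ) < M := by exact_mod_cast hM
  have hle : ((N / M : ℕ) : ℝ) ≤ N / M := Nat.cast_div_le
  have hlt : (N : ℝ) / M < (N / M : ℕ) + 1 := by
    rw [div_lt_iff₀ hM']
    exact_mod_cast (Nat.lt_mul_div_succ N hM).trans_eq (mul_comm _ _)
  have hc : (((Finset.range N).filter (· ≡ r [MOD M])).card : ℝ)
      = (N / M : ℕ) + if r % M < N % M then 1 else 0 := by
    convert congrArg (Nat.cast : ℕ → ℝ) h using 1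
    push_cast
    congr 1
  rw [hc, abs_le]
  split_ifs <;> constructor <;> linarith

open scoped Classical in
lemma abs_card_radInv_lt_sub_le {b : ℕ} (hb : 2 ≤ b) {N K : ℕ} (hN : N ≤ b ^ K) (Q : ℕ → Prop)
    {W E : ℝ} (hE : 1 ≤ E) (hW0 : 0 ≤ W) (hWN : W ≤ N)
    (hQ : ∀ k r : ℕ,
      |(((Finset.range N).filter fun n => n ≡ r [MOD b ^ k] ∧ Q n).card : ℝ) - W / (b : ℝ) ^ k| ≤ E)
    {y : ℝ} (hy0 : 0 ≤ y) (hy1 : y ≤ 1) :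
    |(((Finset.range N).filter fun n => radInv b n < y ∧ Q n).card : ℝ) - W * y|
      ≤ (K + 1) * b * E := by
  have hb2 : (2 : ℝ) ≤ b := by exact_mod_cast hb
  have hbpos : ∀ k : ℕ, (0 : ℝ) < (b : ℝ) ^ k := fun k => by positivity
  set A : ℝ → Finset ℕ := fun z => (Finset.range N).filter fun n => radInv b n < z ∧ Q n with hA
  set g : ℝ → ℝ := fun z => ((A z).card : ℝ) with hg
  have hgmono : Monotone g := fun z w hzw => by
    refine Nat.cast_le.mpr (Finset.card_le_card fun n hn => ?_)
    simp only [hA, Finset.mem_filter] at hn ⊢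
    exact ⟨hn.1, hn.2.1.trans_le hzw, hn.2.2⟩
  have hincr : ∀ k a : ℕ, a < b ^ k → ∃ r : ℕ,
      g (((a : ℝ) + 1) / (b : ℝ) ^ k) - g ((a : ℝ) / (b : ℝ) ^ k)
        = ((Finset.range N).filter fun n => n ≡ r [MOD b ^ k] ∧ Q n).card := by
    intro k a ha
    obtain ⟨r, hr⟩ := exists_radInv_mem_elementary_iff hb k a ha
    refine ⟨r, ?_⟩
    have hle : (a : ℝ) / (b : ℝ) ^ k ≤ ((a : ℝ) + 1) / (b : ℝ) ^ k := by gcongr; linarith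
    rw [sub_eq_iff_eq_add]
    simp only [hg]
    rw [← Nat.cast_add, ← Finset.card_union_of_disjoint]
    · congr 2
      ext n
      simp only [hA, Finset.mem_filter, Finset.mem_union, ← hr]
      constructor
      · rintro ⟨hn, hlt, hq⟩
        rcases lt_or_ge (radInv b n) ((a : ℝ) / (b : ℝ) ^ k) with h | h
        · exact Or.inr ⟨hn, h, hq⟩
        · exact Or.inl ⟨hn, ⟨h, hlt⟩, hq⟩
      · rintro (⟨hn, h, hq⟩ | ⟨hn, h, hq⟩)
        · exact ⟨hn, h.2, hq⟩
        · exact ⟨hn, h.trans_le hle, hq⟩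
    · rw [Finset.disjoint_left]
      intro n h1 h2
      simp only [hA, Finset.mem_filter, ← hr] at h1 h2
      exact absurd h2.2.1 (not_lt.mpr h1.2.1.1)
  have hg0 : g 0 - W * 0 = 0 := by
    have : A 0 = ∅ := Finset.filter_eq_empty_iff.mpr fun n _ h =>
      absurd h.1 (not_lt.mpr (radInv_nonneg b n))
    simp [hg, this]
  have hgrid := abs_le_of_elementary_increments (e := fun z => g z - W * z) hb hg0 (E := E)
    (fun k a ha => by
      obtain ⟨r, hr⟩ := hincr k a ha
      have h := hQ k r
      rw [← hr] at h
      convert h using 2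
      have := (hbpos k).ne'
      field_simp
      ring) K
  change |g y - W * y| ≤ _
  have hKb : 0 ≤ (K : ℝ) * b := by positivity
  have hKE : 0 ≤ (K : ℝ) * E := by positivity
  have hbE : 2 * E ≤ b * E := mul_le_mul_of_nonneg_right hb2 (by linarith)
  have hfloor : (⌊y * (b : ℝ) ^ K⌋₊ : ℝ) ≤ y * (b : ℝ) ^ K := Nat.floor_le (by positivity)
  have hfloor' := Nat.lt_floor_add_one (y * (b : ℝ) ^ K)
  set m := ⌊y * (b : ℝ) ^ K⌋₊ with hm
  have hmle : m ≤ b ^ K := by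
    exact_mod_cast hfloor.trans (mul_le_of_le_one_left (hbpos K).le hy1)
  have hgm := hgrid m hmle
  have hlow : (m : ℝ) / (b : ℝ) ^ K ≤ y := (div_le_iff₀ (hbpos K)).mpr hfloor
  have hupp : y ≤ ((m : ℝ) + 1) / (b : ℝ) ^ K := (le_div_iff₀ (hbpos K)).mpr hfloor'.le
  rcases hmle.eq_or_lt with heq | hlt
  · have hy : y = (m : ℝ) / (b : ℝ) ^ K := by
      refine le_antisymm ?_ hlow
      rw [heq, Nat.cast_pow, div_self (hbpos K).ne']
      exact hy1
    rw [← hy] at hgm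
    refine hgm.trans ?_
    nlinarith
  · obtain ⟨r, hr⟩ := hincr K m hlt
    have hNb : (N : ℝ) ≤ (b : ℝ) ^ K := by exact_mod_cast hN
    have hone : g (((m : ℝ) + 1) / (b : ℝ) ^ K) - g ((m : ℝ) / (b : ℝ) ^ K) ≤ 1 := by
      rw [hr]
      refine Nat.cast_le_one.mpr (Finset.card_le_one.mpr fun x hx z hz => ?_)
      simp only [Finset.mem_filter, Finset.mem_range] at hx hz
      exact Nat.ModEq.eq_of_lt_of_lt (hx.2.1.trans hz.2.1.symm) (hx.1.trans_le hN)
        (hz.1.trans_le hN)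
    have hW : W * (y - (m : ℝ) / (b : ℝ) ^ K) ≤ 1 := by
      have hyd : y - (m : ℝ) / (b : ℝ) ^ K ≤ 1 / (b : ℝ) ^ K := by
        rw [add_div] at hupp
        linarith
      calc W * (y - (m : ℝ) / (b : ℝ) ^ K)
          ≤ (b : ℝ) ^ K * (1 / (b : ℝ) ^ K) :=
            mul_le_mul (hWN.trans hNb) hyd (by linarith) (hbpos K).le
        _ = 1 := mul_one_div_cancel (hbpos K).ne'
    have hW' : 0 ≤ W * (y - (m : ℝ) / (b : ℝ) ^ K) := mul_nonneg hW0 (by linarith)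
    have h1 := hgmono hlow
    have h2 := hgmono hupp
    have hfin : ((K : ℝ) * (b - 1) + 1) * E + 1 ≤ (K + 1) * b * E := by nlinarith
    rw [abs_le] at hgm ⊢
    constructor <;> nlinarith [hgm.1, hgm.2]

open scoped Classical in
/-- Counting the points of a Halton-type sequence in a box, along a residue class. -/
theorem abs_card_box_sub_le {ι : Type*} (b : ι → ℕ) (α : ι → ℝ) {N K : ℕ} (hN : N ≤ 2 ^ K)
    (s : Finset ι) (hb : ∀ i ∈ s, 2 ≤ b i)
    (hcop : (s : Set ι).Pairwise (Function.onFun Nat.Coprime b))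
    (hα : ∀ i ∈ s, 0 ≤ α i ∧ α i ≤ 1) :
    ∀ M r : ℕ, 0 < M → (∀ i ∈ s, Nat.Coprime M (b i)) →
      |(((Finset.range N).filter fun n =>
          n ≡ r [MOD M] ∧ ∀ i ∈ s, radInv (b i) n < α i).card : ℝ) - N / M * ∏ i ∈ s, α i|
        ≤ ∏ i ∈ s, ((K + 1) * (b i : ℝ)) := by
  induction s using Finset.induction_on with
  | empty =>
    intro M r hM _
    simpa using abs_card_modEq_sub_le N hM r
  | insert i s his ih =>
    intro M r hM hMb
    simp only [Finset.forall_mem_insert] at hb hα hMb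
    rw [Finset.coe_insert, Set.pairwise_insert] at hcop
    have hM1 : (1 : ℝ) ≤ M := by exact_mod_cast hM
    have hV0 : 0 ≤ ∏ j ∈ s, α j := Finset.prod_nonneg fun j hj => (hα.2 j hj).1
    have hV1 : ∏ j ∈ s, α j ≤ 1 :=
      Finset.prod_le_one (fun j hj => (hα.2 j hj).1) fun j hj => (hα.2 j hj).2
    have hE : 1 ≤ ∏ j ∈ s, ((K + 1) * (b j : ℝ)) := by
      refine Finset.one_le_prod fun j hj => ?_
      have : (2 : ℝ) ≤ b j := by exact_mod_cast hb.2 j hj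
      nlinarith [(Nat.cast_nonneg K : (0 : ℝ) ≤ K)]
    have hNM : (N : ℝ) / M ≤ N := div_le_self (Nat.cast_nonneg N) hM1
    have key := abs_card_radInv_lt_sub_le hb.1 (hN.trans (Nat.pow_le_pow_left hb.1 K))
      (fun n => n ≡ r [MOD M] ∧ ∀ j ∈ s, radInv (b j) n < α j) hE
      (W := N / M * ∏ j ∈ s, α j) (by positivity)
      ((mul_le_of_le_one_right (by positivity) hV1).trans hNM)
      (fun k r' => by
        have hc : Nat.Coprime (b i ^ k) M := (hMb.1.symm).pow_left k
        obtain ⟨z, hz1, hz2⟩ := Nat.chineseRemainder hc r' r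
        have := ih hb.2 hcop.1 hα.2 (b i ^ k * M) z
          (Nat.mul_pos (pow_pos (by lia) k) hM) fun j hj =>
            Nat.Coprime.mul_left (Nat.Coprime.pow_left k
              (hcop.2 j hj (fun h => his (h ▸ hj))).1) (hMb.2 j hj)
        convert this using 3
        · congr 2
          ext n
          simp only [Finset.mem_filter]
          refine and_congr_right fun _ => ?_
          rw [← Nat.modEq_and_modEq_iff_modEq_mul hc, ← and_assoc]
          refine and_congr_left fun _ => and_congr ?_ ?_
          · exact ⟨fun h => h.trans hz1.symm, fun h => h.trans hz1⟩
          · exact ⟨fun h => h.trans hz2.symm, fun h => h.trans hz2⟩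
        · have : (0 : ℝ) < b i := by exact_mod_cast (by lia : 0 < b i)
          push_cast
          field_simp)
      hα.1.1 hα.1.2
    rw [Finset.prod_insert his, Finset.prod_insert his]
    convert key using 3
    · congr 2
      ext n
      simp only [Finset.mem_filter, Finset.forall_mem_insert]
      tauto
    · ring

lemma starDisc_nonneg {ι : Type} [Fintype ι] (N : ℕ) (P : Fin N → ι → ℝ) : 0 ≤ starDisc N P :=
  Real.sSup_nonneg fun _ ⟨_, _, ht⟩ => ht ▸ abs_nonneg _

lemma starDisc_le {ι : Type} [Fintype ι] {N : ℕ} {P : Fin N → ι → ℝ} {B : ℝ}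
    (h : ∀ α : ι → ℝ, (∀ i, 0 ≤ α i ∧ α i ≤ 1) →
      |((Finset.univ.filter fun n : Fin N => ∀ i, 0 ≤ P n i ∧ P n i < α i).card : ℝ) / N
        - ∏ i, α i| ≤ B) : starDisc N P ≤ B := by
  classical
  refine csSup_le ⟨_, fun _ => 0, by simp, rfl⟩ ?_
  rintro t ⟨α, hα, rfl⟩
  convert h α hα

lemma starDisc_le_one {ι : Type} [Fintype ι] (N : ℕ) (P : Fin N → ι → ℝ) : starDisc N P ≤ 1 := by
  classical
  refine starDisc_le fun α hα => ?_
  have hcard : ((Finset.univ.filter fun n : Fin N => ∀ i, 0 ≤ P n i ∧ P n i < α i).card : ℝ) / N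
      ≤ 1 := by
    refine div_le_one_of_le₀ ?_ (Nat.cast_nonneg N)
    exact_mod_cast (Finset.card_le_univ _).trans_eq (Fintype.card_fin N)
  have hcard0 : 0 ≤
      ((Finset.univ.filter fun n : Fin N => ∀ i, 0 ≤ P n i ∧ P n i < α i).card : ℝ) / N := by
    positivity
  have h0 : 0 ≤ ∏ i, α i := Finset.prod_nonneg fun i _ => (hα i).1
  have h1 : ∏ i, α i ≤ 1 := Finset.prod_le_one (fun i _ => (hα i).1) fun i _ => (hα i).2
  rw [abs_le]
  constructor <;> linarith

lemma starDisc_radInv_le {ι : Type} [Fintype ι] {b : ι → ℕ} (hb : ∀ i, 2 ≤ b i)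
    (hcop : Pairwise (Function.onFun Nat.Coprime b)) {N K : ℕ} (hN0 : 0 < N) (hN : N ≤ 2 ^ K) :
    starDisc N (fun n i => radInv (b i) n) ≤ (∏ i, ((K + 1) * (b i : ℝ))) / N := by
  classical
  refine starDisc_le fun α hα => ?_
  have key := abs_card_box_sub_le b α hN Finset.univ (fun i _ => hb i)
    (fun i _ j _ hij => hcop hij) (fun i _ => hα i) 1 0 one_pos (fun i _ => Nat.coprime_one_left _)
  have hcard : (Finset.univ.filter fun n : Fin N =>
        ∀ i, 0 ≤ radInv (b i) n ∧ radInv (b i) n < α i).card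
      = ((Finset.range N).filter fun n =>
          n ≡ 0 [MOD 1] ∧ ∀ i ∈ Finset.univ, radInv (b i) n < α i).card := by
    simp only [Finset.card_filter, Nat.modEq_one, radInv_nonneg, true_and, Finset.mem_univ,
      true_implies]
    exact Fin.sum_univ_eq_sum_range (fun n => if ∀ i, radInv (b i) n < α i then 1 else 0) N
  have hN' : (0 : ℝ) < N := by exact_mod_cast hN0
  have hdiv : ∀ c p : ℝ, c / N - p = (c - N / (1 : ℕ) * p) / N := fun c p => by
    field_simp
    simp
  rw [hdiv, abs_div, abs_of_pos hN', hcard]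
  gcongr
  refine le_of_eq_of_le
    (congrArg (fun c : ℕ => |(c : ℝ) - N / (1 : ℕ) * ∏ i, α i|) ?_) key
  congr!

/-! ### Growth estimates -/

lemma nth_prime_rpow_le {δ : ℝ} (hδ : 0 < δ) (j : ℕ) :
    (Nat.nth Nat.Prime j : ℝ) ^ (1 - δ) ≤ 3 / (δ * Real.log 2) * ((j : ℝ) + 1) := by
  set p := Nat.nth Nat.Prime j with hp
  have hprime : p.Prime := Nat.prime_nth_prime j
  have hp2 : (2 : ℝ) ≤ p := by exact_mod_cast hprime.two_le
  have hp0 : (0 : ℝ) < p := by linarith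
  have hlog : 0 < Real.log p := Real.log_pos (by linarith)
  have hlog2 : 0 < Real.log 2 := Real.log_pos one_lt_two
  have hpi : Nat.primeCounting p = j + 1 := by
    rw [Nat.primeCounting_eq_primeCounting'_succ, Nat.primeCounting', Nat.count_succ,
      if_pos hprime]
    exact congrArg (· + 1) (Nat.primeCounting'_nth_eq j)
  have hge := Chebyshev.pi_ge p
  rw [hpi, div_le_iff₀ hlog] at hge
  have hlog1 : Real.log ((p : ℝ) + 1) ≤ 2 * Real.log p := by
    rw [← Real.log_rpow hp0]
    refine Real.log_le_log (by linarith) ?_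
    rw [Real.rpow_two]
    nlinarith
  have hlogp : Real.log p ≤ (p : ℝ) ^ δ / δ := Real.log_le_rpow_div hp0.le hδ
  push_cast at hge
  have hj : (0 : ℝ) ≤ j := Nat.cast_nonneg j
  have hmain : (p : ℝ) * Real.log 2 ≤ 3 * ((j : ℝ) + 1) * ((p : ℝ) ^ δ / δ) := by
    nlinarith
  rw [Real.rpow_sub hp0, Real.rpow_one, div_le_iff₀ (by positivity)]
  calc (p : ℝ) = (p : ℝ) * Real.log 2 / Real.log 2 := by field_simp
    _ ≤ 3 * ((j : ℝ) + 1) * ((p : ℝ) ^ δ / δ) / Real.log 2 := by gcongr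
    _ = 3 / (δ * Real.log 2) * ((j : ℝ) + 1) * (p : ℝ) ^ δ := by field_simp

lemma factorial_card_le_prod_succ (s : Finset ℕ) : s.card.factorial ≤ ∏ j ∈ s, (j + 1) := by
  induction s using Finset.induction_on_max with
  | empty => simp
  | insert a s hlt ih =>
    have ha : a ∉ s := fun h => lt_irrefl a (hlt a h)
    have hcard : s.card ≤ a := by
      simpa using Finset.card_le_card (fun x hx => Finset.mem_range.mpr (hlt x hx) :
        s ⊆ Finset.range a)
    rw [Finset.prod_insert ha, Finset.card_insert_of_notMem ha, Nat.factorial_succ]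
    gcongr

lemma prod_div_succ_le_exp {X : ℝ} (hX : 0 ≤ X) (s : Finset ℕ) :
    ∏ j ∈ s, X / ((j : ℝ) + 1) ≤ Real.exp X := by
  have hfac : ((s.card.factorial : ℕ) : ℝ) ≤ ∏ j ∈ s, ((j : ℝ) + 1) := by
    exact_mod_cast factorial_card_le_prod_succ s
  rw [Finset.prod_div_distrib, Finset.prod_const]
  refine le_trans ?_ (Real.pow_div_factorial_le_exp X hX s.card)
  gcongr

lemma exists_rpow_le_mul_add {δ η : ℝ} (hδ0 : 0 < δ) (hδ1 : δ < 1) (hη : 0 < η) :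
    ∃ c : ℝ, ∀ y : ℝ, 0 < y → y ^ (1 - δ) ≤ η * y + c := by
  refine ⟨(η ^ (-δ⁻¹)) ^ (1 - δ), fun y hy => ?_⟩
  have hT : 0 < η ^ (-δ⁻¹) := by positivity
  rcases le_total y (η ^ (-δ⁻¹)) with h | h
  · have := Real.rpow_le_rpow hy.le h (by linarith : 0 ≤ 1 - δ)
    nlinarith
  · have h1 : y ^ (-δ) ≤ η := by
      calc y ^ (-δ) ≤ (η ^ (-δ⁻¹)) ^ (-δ) :=
            Real.rpow_le_rpow_of_nonpos hT h (by linarith)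
        _ = η := by
            rw [← Real.rpow_mul hη.le, neg_mul_neg, inv_mul_cancel₀ hδ0.ne', Real.rpow_one]
    have h2 : y ^ (1 - δ) = y ^ (-δ) * y := by
      rw [sub_eq_neg_add, Real.rpow_add hy, Real.rpow_one]
    have h3 : 0 ≤ (η ^ (-δ⁻¹)) ^ (1 - δ) := by positivity
    rw [h2]
    nlinarith

lemma clog_two_le {N : ℕ} (hN : 1 ≤ N) : (Nat.clog 2 N : ℝ) ≤ Real.log N / Real.log 2 + 1 := by
  have hlog2 : 0 < Real.log 2 := Real.log_pos one_lt_two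
  have hlogN : 0 ≤ Real.log N := Real.log_natCast_nonneg N
  rcases hN.eq_or_lt with rfl | hN1
  · simp
  · have hpow := Nat.pow_pred_clog_lt_self one_lt_two hN1
    have hpow' : (2 : ℝ) ^ (Nat.clog 2 N).pred ≤ N := by exact_mod_cast hpow.le
    have h := Real.log_le_log (by positivity) hpow'
    rw [Real.log_pow] at h
    have hpred : (Nat.clog 2 N : ℝ) ≤ (Nat.clog 2 N).pred + 1 := by
      exact_mod_cast
        (Nat.sub_le_iff_le_add.mp le_rfl : Nat.clog 2 N ≤ (Nat.clog 2 N).pred + 1)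
    have := (le_div_iff₀ hlog2).mpr h
    linarith

lemma exists_exp_clog_rpow_le {A δ : ℝ} (hA : 0 < A) (hδ0 : 0 < δ) (hδ1 : δ < 1) :
    ∃ C : ℝ, 0 < C ∧ ∀ N : ℕ, 1 ≤ N →
      Real.exp (A * ((Nat.clog 2 N : ℝ) + 1) ^ (1 - δ)) ≤ C * (N : ℝ) ^ δ := by
  have hlog2 : 0 < Real.log 2 := Real.log_pos one_lt_two
  obtain ⟨c, hc⟩ := exists_rpow_le_mul_add hδ0 hδ1
    (show 0 < δ * Real.log 2 / A by positivity)
  refine ⟨Real.exp (2 * δ * Real.log 2 + A * c), Real.exp_pos _, fun N hN => ?_⟩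
  have hN0 : (0 : ℝ) < N := by exact_mod_cast hN
  rw [Real.rpow_def_of_pos hN0, ← Real.exp_add, Real.exp_le_exp]
  have hK := clog_two_le hN
  calc A * ((Nat.clog 2 N : ℝ) + 1) ^ (1 - δ)
      ≤ A * (δ * Real.log 2 / A * ((Nat.clog 2 N : ℝ) + 1) + c) := by
        gcongr
        exact hc _ (by positivity)
    _ ≤ A * (δ * Real.log 2 / A * (Real.log N / Real.log 2 + 1 + 1) + c) := by gcongr
    _ = 2 * δ * Real.log 2 + A * c + Real.log N * δ := by
        field_simp
        ring

/-! ### The Halton sequence -/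

lemma haltonProjStarDisc_le {d N : ℕ} (hN : 1 ≤ N) (u : Finset (Fin d)) :
    haltonProjStarDisc d N u
      ≤ (∏ j ∈ u, (((Nat.clog 2 N : ℝ) + 1) * (Nat.nth Nat.Prime j : ℝ))) / N := by
  rw [← Finset.prod_coe_sort]
  refine starDisc_radInv_le (b := fun i : u => Nat.nth Nat.Prime i.1)
    (fun i => (Nat.prime_nth_prime _).two_le) (fun i j hij => ?_) hN
    (Nat.le_pow_clog one_lt_two N)
  refine (Nat.coprime_primes (Nat.prime_nth_prime _) (Nat.prime_nth_prime _)).mpr fun h => hij ?_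
  exact Subtype.ext (Fin.ext (Nat.nth_injective Nat.infinite_setOfPred_prime h))

/-- The unweighted bound: uniformly in `d` and `u`, the star discrepancy of the projection is
`O(N^{-(1/2-δ)})` up to the factor `∏_{j ∈ u} j`. -/
lemma exists_haltonProjStarDisc_le {δ : ℝ} (hδ0 : 0 < δ) (hδ1 : δ < 1) :
    ∃ C : ℝ, 0 < C ∧ ∀ (d N : ℕ) (u : Finset (Fin d)), 1 ≤ N →
      haltonProjStarDisc d N u ≤ C / (N : ℝ) ^ (1 / 2 - δ) * ∏ j ∈ u, ((j.1 + 1 : ℕ) : ℝ) := by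
  have hlog2 : 0 < Real.log 2 := Real.log_pos one_lt_two
  set A : ℝ := 3 / (δ * Real.log 2) with hA
  have hA0 : 0 < A := by positivity
  obtain ⟨C, hC0, hC⟩ := exists_exp_clog_rpow_le hA0 hδ0 hδ1
  refine ⟨√C, Real.sqrt_pos.mpr hC0, fun d N u hN => ?_⟩
  have hN0 : (0 : ℝ) < N := by exact_mod_cast hN
  set L : ℝ := (Nat.clog 2 N : ℝ) + 1 with hL
  have hL0 : 0 < L := by positivity
  set X : ℝ := A * L ^ (1 - δ) with hX
  set D := haltonProjStarDisc d N u with hD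
  have hD0 : 0 ≤ D := starDisc_nonneg _ _
  have hD1 : D ≤ 1 := starDisc_le_one _ _
  set P : ℝ := ∏ j ∈ u, ((j.1 + 1 : ℕ) : ℝ) with hP
  have hP0 : 0 ≤ P := Finset.prod_nonneg fun _ _ => Nat.cast_nonneg _
  have hfactor : ∀ j : Fin d, (L * (Nat.nth Nat.Prime j : ℝ)) ^ (1 - δ)
      ≤ X / ((j.1 : ℝ) + 1) * ((j.1 + 1 : ℕ) : ℝ) ^ 2 := by
    intro j
    rw [Real.mul_rpow hL0.le (Nat.cast_nonneg _)]
    calc L ^ (1 - δ) * (Nat.nth Nat.Prime j : ℝ) ^ (1 - δ)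
        ≤ L ^ (1 - δ) * (A * ((j.1 : ℝ) + 1)) := by
          gcongr
          exact nth_prime_rpow_le hδ0 j
      _ = X / ((j.1 : ℝ) + 1) * ((j.1 + 1 : ℕ) : ℝ) ^ 2 := by
          push_cast
          field_simp
          rw [hX]
          ring
  have hexp : ∏ j ∈ u, X / ((j.1 : ℝ) + 1) ≤ Real.exp X := by
    simpa using prod_div_succ_le_exp (show 0 ≤ X by positivity) (u.map Fin.valEmbedding)
  have hsq : D ^ 2 ≤ (√C / (N : ℝ) ^ (1 / 2 - δ) * P) ^ 2 := by
    calc D ^ 2 = D ^ (2 : ℝ) := (Real.rpow_two D).symm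
      _ ≤ D ^ (1 - δ) := Real.rpow_le_rpow_of_exponent_ge' hD0 hD1 (by linarith) (by linarith)
      _ ≤ ((∏ j ∈ u, (L * (Nat.nth Nat.Prime j : ℝ))) / N) ^ (1 - δ) :=
          Real.rpow_le_rpow hD0 (haltonProjStarDisc_le hN u) (by linarith)
      _ = (∏ j ∈ u, (L * (Nat.nth Nat.Prime j : ℝ)) ^ (1 - δ)) / (N : ℝ) ^ (1 - δ) := by
          rw [Real.div_rpow (Finset.prod_nonneg fun _ _ => by positivity) hN0.le,
            ← Real.finsetProd_rpow _ _ fun _ _ => by positivity]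
      _ ≤ (∏ j ∈ u, X / ((j.1 : ℝ) + 1) * ((j.1 + 1 : ℕ) : ℝ) ^ 2) / (N : ℝ) ^ (1 - δ) := by
          gcongr with j hj
          exact hfactor j
      _ = (∏ j ∈ u, X / ((j.1 : ℝ) + 1)) * P ^ 2 / (N : ℝ) ^ (1 - δ) := by
          rw [Finset.prod_mul_distrib, Finset.prod_pow]
      _ ≤ C * (N : ℝ) ^ δ * P ^ 2 / (N : ℝ) ^ (1 - δ) := by
          gcongr
          exact hexp.trans (hC N hN)
      _ = (√C / (N : ℝ) ^ (1 / 2 - δ) * P) ^ 2 := by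
          have hNpow : (N : ℝ) ^ (1 - δ) = (N : ℝ) ^ δ * ((N : ℝ) ^ (1 / 2 - δ)) ^ 2 := by
            rw [← Real.rpow_natCast, ← Real.rpow_mul hN0.le, ← Real.rpow_add hN0]
            congr 1
            push_cast
            ring
          rw [mul_pow, div_pow, Real.sq_sqrt hC0.le, hNpow]
          field_simp
  exact (sq_le_sq₀ hD0 (by positivity)).mp hsq

/-- For every `δ ∈ (0,1/2)` there is `C_δ > 0` with
`D*_{N,γ}(H_{d,N}) ≤ (C_δ/N^{1/2−δ}) · max_{∅≠u⊆[d]} ∏_{j∈u} (j·γ_j)`. -/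
theorem halton_weighted_star_disc_half_bound
    (γ : ℕ → ℝ) (hpos : ∀ j : ℕ, 1 ≤ j → 0 < γ j)
    (hmono : ∀ j : ℕ, 1 ≤ j → γ (j + 1) ≤ γ j) :
    ∀ δ : ℝ, 0 < δ → δ < 1 / 2 → ∃ C : ℝ, 0 < C ∧
      ∀ d : ℕ, 1 ≤ d → ∀ N : ℕ, 1 ≤ N →
        wHaltonStarDisc γ d N ≤
          C / (N : ℝ) ^ (1 / 2 - δ) *
            sSup {t : ℝ | ∃ u : Finset (Fin d), u.Nonempty ∧
              t = ∏ j ∈ u, (((j.1 + 1 : ℕ) : ℝ) * γ (j.1 + 1))} := by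
  intro δ hδ0 hδ1
  obtain ⟨C, hC0, hC⟩ := exists_haltonProjStarDisc_le hδ0 (by linarith : δ < 1)
  refine ⟨C, hC0, fun d hd N hN => ?_⟩
  refine csSup_le ⟨_, {⟨0, hd⟩}, Finset.singleton_nonempty _, rfl⟩ ?_
  rintro t ⟨u, hu, rfl⟩
  have hγ : 0 ≤ ∏ j ∈ u, γ (j.1 + 1) :=
    Finset.prod_nonneg fun j _ => (hpos (j.1 + 1) (by lia)).le
  have hbdd : BddAbove {t : ℝ | ∃ u : Finset (Fin d), u.Nonempty ∧
      t = ∏ j ∈ u, (((j.1 + 1 : ℕ) : ℝ) * γ (j.1 + 1))} := by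
    refine (Set.Finite.subset (Set.finite_range fun u : Finset (Fin d) =>
      ∏ j ∈ u, (((j.1 + 1 : ℕ) : ℝ) * γ (j.1 + 1))) ?_).bddAbove
    rintro t ⟨v, _, rfl⟩
    exact ⟨v, rfl⟩
  calc (∏ j ∈ u, γ (j.1 + 1)) * haltonProjStarDisc d N u
      ≤ (∏ j ∈ u, γ (j.1 + 1)) *
          (C / (N : ℝ) ^ (1 / 2 - δ) * ∏ j ∈ u, ((j.1 + 1 : ℕ) : ℝ)) :=
        mul_le_mul_of_nonneg_left (hC d N u hN) hγ
    _ = C / (N : ℝ) ^ (1 / 2 - δ) * ∏ j ∈ u, (((j.1 + 1 : ℕ) : ℝ) * γ (j.1 + 1)) := by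
        rw [Finset.prod_mul_distrib]
        ring
    _ ≤ _ := mul_le_mul_of_nonneg_left (le_csSup hbdd ⟨u, hu, rfl⟩) (by positivity)
end
end

section
/- For every dimension d ≥ 1, every nonempty subset u ⊆ {1,…,d}, and every integer N ≥ 2, the unanchored discrepancy of the projection onto the coordinates in u of the first N points of the d-dimensional Halton sequence satisfies D_N(H_{d,N}(u)) ≤ ((log N)^{|u|}/N) · ∏_{j∈u} 12j. -/
open Finset Real

noncomputable section

open scoped Classical in
/-- Unanchored discrepancy of the point set `P` of `N` points:
`D_N(P) = sup_{0 ≤ a ≤ b ≤ 1} |#{n : P n ∈ [a,b)}/N − ∏ᵢ (bᵢ − aᵢ)|`. -/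
def unanchoredDisc {ι : Type} [Fintype ι] (N : ℕ) (P : Fin N → ι → ℝ) : ℝ :=
  sSup {t : ℝ | ∃ a b : ι → ℝ, (∀ i, 0 ≤ a i ∧ a i ≤ b i ∧ b i ≤ 1) ∧
    t = |((Finset.univ.filter fun n : Fin N => ∀ i, a i ≤ P n i ∧ P n i < b i).card : ℝ) / N
          - ∏ i, (b i - a i)|}

/-- Unanchored discrepancy of the projection of the first `N` points of the
`d`-dimensional Halton sequence onto the coordinates in `u`. -/
def haltonProjUnanchDisc (d N : ℕ) (u : Finset (Fin d)) : ℝ :=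
  unanchoredDisc N fun n (i : u) => halton d n i.1

/-- Weighted unanchored discrepancy of the first `N` points of the `d`-dimensional
Halton sequence with product weights `γ` (1-based). -/
def wHaltonUnanchDisc (γ : ℕ → ℝ) (d N : ℕ) : ℝ :=
  sSup {t : ℝ | ∃ u : Finset (Fin d), u.Nonempty ∧
    t = (∏ j ∈ u, γ (j.1 + 1)) * haltonProjUnanchDisc d N u}

/-- The first `K` base-`p` digits of `n` in reversed order, read as an integer. -/
def digitRev (p : ℕ) : ℕ → ℕ → ℕ
  | 0, _ => 0
  | K + 1, n => (n % p) * p ^ K + digitRev p K (n / p)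

lemma digitRev_lt {p : ℕ} (hp : 0 < p) : ∀ K n, digitRev p K n < p ^ K
  | 0, _ => by simp [digitRev]
  | K + 1, n => by
    have h := digitRev_lt hp K (n / p)
    have h2 := Nat.mod_lt n hp
    calc digitRev p (K + 1) n < (n % p) * p ^ K + p ^ K := by simp only [digitRev]; omega
      _ = (n % p + 1) * p ^ K := by ring
      _ ≤ p * p ^ K := Nat.mul_le_mul_right _ h2
      _ = p ^ (K + 1) := by ring

lemma digitRev_succ_lt_iff {p : ℕ} (hp : 0 < p) (K n B : ℕ) :
    digitRev p (K + 1) n < B ↔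
      n % p < B / p ^ K ∨ n % p = B / p ^ K ∧ digitRev p K (n / p) < B % p ^ K := by
  have h1 := digitRev_lt hp K (n / p)
  have h2 := Nat.div_add_mod B (p ^ K)
  have h3 := Nat.mod_lt B (pow_pos hp K)
  simp only [digitRev]
  rcases lt_trichotomy (n % p) (B / p ^ K) with h | h | h
  · have : (n % p + 1) * p ^ K ≤ B / p ^ K * p ^ K := Nat.mul_le_mul_right _ h
    have h4 := Nat.div_mul_le_self B (p ^ K)
    rw [add_mul, one_mul] at this
    simp only [h, true_or, iff_true]
    omega
  · rw [h, mul_comm (B / p ^ K)]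
    simp only [lt_irrefl, true_and, false_or]
    omega
  · have : (B / p ^ K + 1) * p ^ K ≤ n % p * p ^ K := Nat.mul_le_mul_right _ h
    have h4 : ¬ n % p < B / p ^ K := by omega
    have h5 : ¬ n % p = B / p ^ K := by omega
    rw [add_mul, one_mul, mul_comm (B / p ^ K)] at this
    simp only [h4, h5, false_and, or_false, iff_false, not_lt]
    omega

/-- `ResSum p f μ m`: the function `f` is a sum of at most `m` indicator functions of residue
classes modulo powers of `p`, with coefficients in `[-1, 1]`, and `f` has mean value `μ`. -/
inductive ResSum (p : ℕ) : (ℕ → ℝ) → ℝ → ℕ → Prop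
  | zero (m : ℕ) : ResSum p (fun _ => 0) 0 m
  | add {f : ℕ → ℝ} {μ : ℝ} {m : ℕ} (c : ℝ) (r k : ℕ) (hc : |c| ≤ 1) (h : ResSum p f μ m) :
      ResSum p (fun n => f n + c * if n ≡ r [MOD p ^ k] then 1 else 0) (μ + c / (p : ℝ) ^ k)
        (m + 1)

namespace ResSum

variable {p : ℕ} {f g : ℕ → ℝ} {μ ν : ℝ} {m l : ℕ}

lemma mono (h : ResSum p f μ m) (hml : m ≤ l) : ResSum p f μ l := by
  induction h generalizing l with
  | zero m => exact zero l
  | add c r k hc _ ih =>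
    obtain ⟨l, rfl⟩ : ∃ l', l = l' + 1 := ⟨l - 1, by omega⟩
    exact add c r k hc (ih (by omega))

lemma sum (hf : ResSum p f μ m) (hg : ResSum p g ν l) :
    ResSum p (fun n => f n + g n) (μ + ν) (m + l) := by
  induction hg with
  | zero l => simpa using hf.mono (Nat.le_add_right m l)
  | add c r k hc _ ih =>
    convert add c r k hc ih using 1
    · funext n; ring
    · ring
    · ring

lemma neg (hf : ResSum p f μ m) : ResSum p (fun n => -f n) (-μ) m := by
  induction hf with
  | zero l => simpa using zero l
  | add c r k hc _ ih =>
    convert add (-c) r k (by simpa using hc) ih using 1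
    · funext n; ring
    · ring

lemma residue (r k : ℕ) :
    ResSum p (fun n => if n ≡ r [MOD p ^ k] then 1 else 0) (1 / (p : ℝ) ^ k) 1 := by
  simpa using add 1 r k (by simp) (zero (p := p) 0)

lemma modEq_add_mul_iff {d q : ℕ} (hd : d < p) (n r : ℕ) :
    n ≡ d + p * r [MOD p * q] ↔ n % p = d ∧ n / p ≡ r [MOD q] := by
  have hp : 0 < p := by omega
  have hmod : (d + p * r) % p = d := by simp [Nat.mod_eq_of_lt hd]
  have hdiv : (d + p * r) / p = r := by
    rw [Nat.add_mul_div_left _ _ hp, Nat.div_eq_of_lt hd, zero_add]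
  unfold Nat.ModEq
  rw [Nat.mod_mul, Nat.mod_mul, hmod, hdiv]
  constructor
  · intro h
    have h1 := congrArg (· % p) h
    simp only [Nat.add_mul_mod_self_left, Nat.mod_mod, Nat.mod_eq_of_lt hd] at h1
    rw [h1] at h
    exact ⟨h1, Nat.eq_of_mul_eq_mul_left hp (by omega)⟩
  · rintro ⟨h1, h2⟩
    rw [h1, h2]

lemma comp_div {d : ℕ} (hd : d < p) (hf : ResSum p f μ m) :
    ResSum p (fun n => if n % p = d then f (n / p) else 0) (μ / p) m := by
  induction hf with
  | zero l => simpa using zero l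
  | add c r k hc _ ih =>
    convert add c (d + p * r) (k + 1) hc ih using 1
    · funext n
      simp only [pow_succ', modEq_add_mul_iff hd]
      by_cases h : n % p = d <;> simp [h]
    · rw [pow_succ]
      ring

lemma mod_lt {d : ℕ} (hd : d ≤ p) :
    ResSum p (fun n => if n % p < d then 1 else 0) ((d : ℝ) / p) d := by
  induction d with
  | zero => simpa using zero 0
  | succ d ih =>
    convert (ih (by omega)).sum (residue d 1) using 1
    · funext n
      have : n ≡ d [MOD p ^ 1] ↔ n % p = d := by
        rw [pow_one, Nat.ModEq, Nat.mod_eq_of_lt (by omega : d < p)]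
      simp only [this]
      rcases lt_trichotomy (n % p) d with h | h | h
      · simp [h, h.ne, Nat.lt_succ_of_lt h]
      · simp [h]
      · simp [h.ne', not_lt.2 h.le, Nat.not_lt.2 (Nat.succ_le_of_lt h)]
    · push_cast; ring

lemma digitRev_lt_of_lt (hp : 0 < p) : ∀ K B : ℕ, B < p ^ K →
    ResSum p (fun n => if digitRev p K n < B then 1 else 0) ((B : ℝ) / (p : ℝ) ^ K)
      ((p - 1) * K)
  | 0, B, hB => by
    obtain rfl : B = 0 := by simpa using hB
    simpa using zero 0
  | K + 1, B, hB => by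
    have hpK : 0 < p ^ K := pow_pos hp K
    have hd : B / p ^ K < p := by
      rw [Nat.div_lt_iff_lt_mul hpK, ← pow_succ']
      exact hB
    have h1 := (digitRev_lt_of_lt hp K (B % p ^ K) (Nat.mod_lt _ hpK)).comp_div hd
    have h2 := (mod_lt hd.le).sum h1
    have h3 := h2.mono (l := (p - 1) * (K + 1)) (by rw [mul_add, mul_one]; omega)
    convert h3 using 1
    · funext n
      simp only [digitRev_succ_lt_iff hp]
      rcases lt_trichotomy (n % p) (B / p ^ K) with h | h | h
      · simp [h, h.ne]
      · simp [h]
      · simp [h.ne', not_lt.2 h.le]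
    · have hB' : (B : ℝ) = p ^ K * (B / p ^ K : ℕ) + (B % p ^ K : ℕ) := by
        exact_mod_cast (Nat.div_add_mod B (p ^ K)).symm
      have : (p : ℝ) ≠ 0 := by positivity
      rw [hB', pow_succ]
      field_simp

lemma digitRev_lt_of_le (hp : 1 < p) {K : ℕ} (hK : 1 ≤ K) {B : ℕ} (hB : B ≤ p ^ K) :
    ResSum p (fun n => if digitRev p K n < B then 1 else 0) ((B : ℝ) / (p : ℝ) ^ K)
      ((p - 1) * K) := by
  rcases hB.lt_or_eq with h | rfl
  · exact digitRev_lt_of_lt (by omega) K B h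
  · have h1 : 1 ≤ (p - 1) * K := Nat.mul_pos (by omega) hK
    convert (residue (p := p) 0 0).mono h1 using 1
    · funext n
      simp [digitRev_lt (by omega : 0 < p), Nat.modEq_one]
    · have : (p : ℝ) ≠ 0 := by positivity
      simp [this]

lemma digitRev_mem (hp : 1 < p) {K : ℕ} (hK : 1 ≤ K) {A B : ℕ} (hAB : A ≤ B)
    (hB : B ≤ p ^ K) :
    ResSum p (fun n => if A ≤ digitRev p K n ∧ digitRev p K n < B then 1 else 0)
      (((B : ℝ) - A) / (p : ℝ) ^ K) (2 * ((p - 1) * K)) := by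
  convert (digitRev_lt_of_le hp hK hB).sum (digitRev_lt_of_le hp hK (hAB.trans hB)).neg using 1
  · funext n
    by_cases h1 : digitRev p K n < A
    · simp [h1, h1.trans_le hAB, not_le.2 h1]
    · simp [h1, not_lt.1 h1]
  · ring
  · ring

end ResSum

lemma abs_sum_modEq_sub_le (N r : ℕ) {M : ℕ} (hM : 0 < M) :
    |(∑ n ∈ range N, if n ≡ r [MOD M] then (1 : ℝ) else 0) - N / M| ≤ 1 := by
  have h : (∑ n ∈ range N, if n ≡ r [MOD M] then (1 : ℝ) else 0)
      = (N.count (· ≡ r [MOD M]) : ℝ) := by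
    rw [Nat.count_eq_card_filter_range]
    simp
  have hdm : (N : ℝ) = M * (N / M : ℕ) + (N % M : ℕ) := by
    exact_mod_cast (Nat.div_add_mod N M).symm
  have hM' : (0 : ℝ) < M := by exact_mod_cast hM
  have hlt : ((N % M : ℕ) : ℝ) / M < 1 := by
    rw [div_lt_one hM']
    exact_mod_cast Nat.mod_lt N hM
  have hnn : 0 ≤ ((N % M : ℕ) : ℝ) / M := by positivity
  have hq : (N : ℝ) / M = (N / M : ℕ) + ((N % M : ℕ) : ℝ) / M := by
    rw [hdm]
    field_simp
  rw [h, Nat.count_modEq_card _ hM, hq, abs_le]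
  split_ifs <;> push_cast <;> constructor <;> linarith

lemma ResSum.abs_sum_mul_sub_le {p : ℕ} {f : ℕ → ℝ} {μ : ℝ} {m : ℕ} (hf : ResSum p f μ m)
    {M : ℕ} (hM : M.Coprime p) {g : ℕ → ℝ} {N : ℕ} {x C : ℝ} (hC : 0 ≤ C)
    (hg : ∀ r k : ℕ, |(∑ n ∈ range N, (if n ≡ r [MOD M * p ^ k] then 1 else 0) * g n)
      - x / (p : ℝ) ^ k| ≤ C) (r : ℕ) :
    |(∑ n ∈ range N, (if n ≡ r [MOD M] then 1 else 0) * (f n * g n)) - μ * x| ≤ m * C := by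
  induction hf with
  | zero m =>
    simp only [zero_mul, mul_zero, sum_const_zero, sub_zero, abs_zero]
    positivity
  | @add f μ m c s k hc _ ih =>
    have hco : M.Coprime (p ^ k) := hM.pow_right k
    set t := (Nat.chineseRemainder hco r s : ℕ)
    have ht' := (Nat.chineseRemainder hco r s).2
    have hiff : ∀ n, n ≡ t [MOD M * p ^ k] ↔ n ≡ r [MOD M] ∧ n ≡ s [MOD p ^ k] := by
      intro n
      rw [← Nat.modEq_and_modEq_iff_modEq_mul hco]
      exact ⟨fun h => ⟨h.1.trans ht'.1, h.2.trans ht'.2⟩,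
        fun h => ⟨h.1.trans ht'.1.symm, h.2.trans ht'.2.symm⟩⟩
    have hsplit : (∑ n ∈ range N, (if n ≡ r [MOD M] then 1 else 0) *
          ((f n + c * if n ≡ s [MOD p ^ k] then 1 else 0) * g n)) - (μ + c / (p : ℝ) ^ k) * x
        = ((∑ n ∈ range N, (if n ≡ r [MOD M] then 1 else 0) * (f n * g n)) - μ * x)
          + c * ((∑ n ∈ range N, (if n ≡ t [MOD M * p ^ k] then 1 else 0) * g n)
            - x / (p : ℝ) ^ k) := by
      have : ∀ n, (if n ≡ r [MOD M] then (1 : ℝ) else 0) *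
          ((f n + c * if n ≡ s [MOD p ^ k] then 1 else 0) * g n)
          = (if n ≡ r [MOD M] then 1 else 0) * (f n * g n)
            + c * ((if n ≡ t [MOD M * p ^ k] then 1 else 0) * g n) := by
        intro n
        simp only [hiff]
        by_cases h1 : n ≡ r [MOD M] <;> by_cases h2 : n ≡ s [MOD p ^ k] <;> simp [h1, h2]; ring
      simp only [this, sum_add_distrib, ← mul_sum]
      ring
    rw [hsplit]
    refine (abs_add_le _ _).trans ?_
    rw [abs_mul]
    have h3 := mul_le_mul hc (hg t k) (abs_nonneg _) zero_le_one
    push_cast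
    linarith

lemma one_le_prod_real {ι : Type} {s : Finset ι} {f : ι → ℝ} (h : ∀ i ∈ s, 1 ≤ f i) :
    1 ≤ ∏ i ∈ s, f i := by
  simpa using prod_le_prod (fun _ _ => zero_le_one) h

/-- Discrepancy of a product of residue sums to pairwise coprime bases, whose mean values are
only known up to `1 / N`. -/
lemma abs_sum_prod_sub_le {ι : Type} [DecidableEq ι] {p : ι → ℕ} (hp : ∀ i, 0 < p i)
    (hco : Pairwise fun i j => (p i).Coprime (p j)) {f : ι → ℕ → ℝ} {μ ν : ι → ℝ} {m : ι → ℕ}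
    (hf : ∀ i, ResSum (p i) (f i) (μ i) (m i)) (hν : ∀ i, |ν i| ≤ 1) {N : ℕ}
    (hμν : ∀ i, |μ i - ν i| * N ≤ 1) (s : Finset ι) :
    ∀ r M : ℕ, 0 < M → (∀ i ∈ s, M.Coprime (p i)) →
      |(∑ n ∈ range N, (if n ≡ r [MOD M] then 1 else 0) * ∏ i ∈ s, f i n)
        - N / M * ∏ i ∈ s, ν i| ≤ ∏ i ∈ s, ((m i : ℝ) + 1) := by
  induction s using Finset.induction_on with
  | empty =>
    intro r M hM _
    simpa using abs_sum_modEq_sub_le N r hM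
  | insert j s hj ih =>
    intro r M hM hMs
    have hC : 1 ≤ ∏ i ∈ s, ((m i : ℝ) + 1) :=
      one_le_prod_real fun i _ => by simp
    have hMR : (1 : ℝ) ≤ M := by exact_mod_cast hM
    have h1 := (hf j).abs_sum_mul_sub_le (hMs j (mem_insert_self j s))
      (g := fun n => ∏ i ∈ s, f i n) (N := N) (x := N / M * ∏ i ∈ s, ν i)
      (C := ∏ i ∈ s, ((m i : ℝ) + 1)) (by linarith) (fun r k => by
        have h := ih r (M * p j ^ k) (Nat.mul_pos hM (pow_pos (hp j) k)) fun i hi =>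
          Nat.Coprime.mul_left (hMs i (mem_insert_of_mem hi))
            ((hco (ne_of_mem_of_not_mem hi hj).symm).pow_left k)
        convert h using 3
        push_cast
        field_simp) r
    have h2 : |(μ j - ν j) * (N / M * ∏ i ∈ s, ν i)| ≤ 1 := by
      have hprod : |∏ i ∈ s, ν i| ≤ 1 := by
        rw [abs_prod]
        exact prod_le_one (fun _ _ => abs_nonneg _) fun i _ => hν i
      have hdiv : (N : ℝ) / M ≤ N := div_le_self (by positivity) hMR
      calc |(μ j - ν j) * (N / M * ∏ i ∈ s, ν i)|
          = |μ j - ν j| * (N / M) * |∏ i ∈ s, ν i| := by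
            rw [abs_mul, abs_mul, abs_of_nonneg (by positivity : (0 : ℝ) ≤ N / M)]
            ring
        _ ≤ |μ j - ν j| * (N / M) * 1 := by gcongr
        _ ≤ |μ j - ν j| * N := by rw [mul_one]; gcongr
        _ ≤ 1 := hμν j
    simp only [prod_insert hj]
    have h3 := (abs_add_le _ _).trans (add_le_add h1 h2)
    have h4 : ∀ S : ℝ, S - N / M * (ν j * ∏ i ∈ s, ν i)
        = S - μ j * (N / M * ∏ i ∈ s, ν i) + (μ j - ν j) * (N / M * ∏ i ∈ s, ν i) := by
      intro S; ring
    rw [h4]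
    linarith

lemma radInv_zero (b : ℕ) : radInv b 0 = 0 := by
  simp [radInv]

lemma radInv_eq_add {b : ℕ} (hb : 1 < b) (n : ℕ) :
    radInv b n = ((n % b : ℕ) : ℝ) / b + radInv b (n / b) / b := by
  have hs : Summable fun i : ℕ => (((n / b ^ i) % b : ℕ) : ℝ) / (b : ℝ) ^ (i + 1) := by
    refine summable_of_ne_finset_zero (s := range n) fun i hi => ?_
    have : n < b ^ i := (Nat.lt_pow_self hb).trans_le
      (Nat.pow_le_pow_right (by omega) (by simpa using hi))
    simp [Nat.div_eq_of_lt this]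
  rw [radInv, hs.tsum_eq_zero_add]
  congr 1
  · simp
  · rw [radInv, ← tsum_div_const]
    refine tsum_congr fun i => ?_
    rw [Nat.div_div_eq_div_mul, ← pow_succ', pow_succ (b : ℝ) (i + 1), div_div]

lemma radInv_eq_digitRev {b : ℕ} (hb : 1 < b) :
    ∀ K n : ℕ, n < b ^ K → radInv b n = (digitRev b K n : ℝ) / (b : ℝ) ^ K
  | 0, n, hn => by
    obtain rfl : n = 0 := by simpa using hn
    simp [radInv_zero, digitRev]
  | K + 1, n, hn => by
    have : n / b < b ^ K := by
      rw [Nat.div_lt_iff_lt_mul (by omega), ← pow_succ]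
      exact hn
    have hb' : (b : ℝ) ≠ 0 := by positivity
    rw [radInv_eq_add hb, radInv_eq_digitRev hb K _ this, digitRev, pow_succ]
    push_cast
    field_simp

/-- An interval of a radical inverse, restricted to indices below `N`, is a short residue sum
with almost the right mean value. -/
lemma exists_resSum_radInv {p N : ℕ} (hp : 1 < p) (hN : 2 ≤ N) {a b : ℝ} (ha : 0 ≤ a)
    (hab : a ≤ b) (hb : b ≤ 1) :
    ∃ (f : ℕ → ℝ) (μ : ℝ), ResSum p f μ (2 * ((p - 1) * Nat.clog p N)) ∧
      |μ - (b - a)| * N ≤ 1 ∧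
      ∀ n < N, f n = if a ≤ radInv p n ∧ radInv p n < b then 1 else 0 := by
  set K := Nat.clog p N
  have hK : 1 ≤ K := Nat.clog_pos hp hN
  have hNK : N ≤ p ^ K := Nat.le_pow_clog hp N
  have hq : (0 : ℝ) < (p : ℝ) ^ K := by positivity
  have hNK' : (N : ℝ) ≤ (p : ℝ) ^ K := by exact_mod_cast hNK
  have hAB : ⌈a * (p : ℝ) ^ K⌉₊ ≤ ⌈b * (p : ℝ) ^ K⌉₊ := Nat.ceil_mono (by gcongr)
  have hB : ⌈b * (p : ℝ) ^ K⌉₊ ≤ p ^ K := by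
    rw [Nat.ceil_le]
    push_cast
    nlinarith
  refine ⟨_, _, ResSum.digitRev_mem hp hK hAB hB, ?_, fun n hn => ?_⟩
  · have h1 := Nat.le_ceil (a * (p : ℝ) ^ K)
    have h2 := Nat.le_ceil (b * (p : ℝ) ^ K)
    have h3 := Nat.ceil_lt_add_one (a := a * (p : ℝ) ^ K) (by positivity)
    have h4 := Nat.ceil_lt_add_one (a := b * (p : ℝ) ^ K) (by have := ha.trans hab; positivity)
    have h5 : |((⌈b * (p : ℝ) ^ K⌉₊ : ℝ) - ⌈a * (p : ℝ) ^ K⌉₊) / (p : ℝ) ^ K - (b - a)|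
        ≤ 1 / (p : ℝ) ^ K := by
      have : ((⌈b * (p : ℝ) ^ K⌉₊ : ℝ) - ⌈a * (p : ℝ) ^ K⌉₊) / (p : ℝ) ^ K - (b - a)
          = ((⌈b * (p : ℝ) ^ K⌉₊ : ℝ) - ⌈a * (p : ℝ) ^ K⌉₊ - (b - a) * (p : ℝ) ^ K)
            / (p : ℝ) ^ K := by field_simp
      rw [this, abs_div, abs_of_pos hq]
      gcongr
      rw [abs_le]
      constructor <;> linarith
    calc _ ≤ 1 / (p : ℝ) ^ K * (p : ℝ) ^ K := by gcongr
      _ = 1 := by field_simp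
  · simp only [radInv_eq_digitRev hp K n (hn.trans_le hNK), le_div_iff₀ hq, div_lt_iff₀ hq,
      Nat.ceil_le, Nat.lt_ceil]

lemma abs_card_sub_le {ι : Type} [Fintype ι] {p : ι → ℕ} (hp : ∀ i, 1 < p i)
    (hco : Pairwise fun i j => (p i).Coprime (p j)) {N : ℕ} (hN : 2 ≤ N) {a b : ι → ℝ}
    (hab : ∀ i, 0 ≤ a i ∧ a i ≤ b i ∧ b i ≤ 1) :
    |((range N).sum fun n => ∏ i, if a i ≤ radInv (p i) n ∧ radInv (p i) n < b i
        then (1 : ℝ) else 0) - N * ∏ i, (b i - a i)|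
      ≤ ∏ i, (((2 * ((p i - 1) * Nat.clog (p i) N) : ℕ) : ℝ) + 1) := by
  classical
  choose f μ hf hμ heq using fun i =>
    exists_resSum_radInv (hp i) hN (hab i).1 (hab i).2.1 (hab i).2.2
  have h := abs_sum_prod_sub_le (fun i => zero_lt_one.trans (hp i)) hco hf
    (ν := fun i => b i - a i) (fun i => by
      obtain ⟨h1, h2, h3⟩ := hab i
      rw [abs_le]
      constructor <;> linarith) hμ univ 0 1 one_pos (by simp)
  simp only [Nat.modEq_one, if_true, one_mul, Nat.cast_one, div_one] at h
  convert h using 3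
  exact sum_congr rfl fun n hn => prod_congr rfl fun i _ => (heq i n (mem_range.1 hn)).symm

lemma le_three_mul_primeCounting_mul_log {n : ℕ} (hn : 2 ≤ n) :
    (n : ℝ) ≤ 3 * (Nat.primeCounting n * Real.log n) := by
  have hlog2 := Real.log_two_gt_d9
  rcases le_or_gt 6 n with h6 | h6
  · have h1 := (Chebyshev.psi_ge n).trans (Chebyshev.psi_le_primeCounting_mul_log n)
    have hn' : (6 : ℝ) ≤ n := by exact_mod_cast h6
    have h2 : Real.log ((n : ℝ) + 1) ≤ ((n : ℝ) + 1) / 8 - 1 + 3 * Real.log 2 := by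
      have h3 := Real.log_le_sub_one_of_pos (by positivity : 0 < ((n : ℝ) + 1) / 8)
      rw [Real.log_div (by positivity) (by norm_num), (by norm_num : (8 : ℝ) = 2 ^ 3),
        Real.log_pow] at h3
      push_cast at h3
      linarith
    nlinarith
  · have hlog : Real.log 2 ≤ Real.log n :=
      Real.log_le_log (by norm_num) (by exact_mod_cast hn)
    have hpi : n ≤ 2 * Nat.primeCounting n := by
      interval_cases n <;> decide
    have hpi' : (n : ℝ) ≤ 2 * Nat.primeCounting n := by exact_mod_cast hpi
    nlinarith [(Nat.cast_nonneg (Nat.primeCounting n) : (0 : ℝ) ≤ _)]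

lemma primeCounting_nth_prime (j : ℕ) : Nat.primeCounting (Nat.nth Nat.Prime j) = j + 1 := by
  rw [Nat.primeCounting, Nat.primeCounting', Nat.count_succ, if_pos (Nat.prime_nth_prime j)]
  congr 1
  exact Nat.primeCounting'_nth_eq j

/-- A factor of the bound that is smaller than `N` dominates the number of residue classes needed
in its coordinate. -/
lemma clog_bound (j : ℕ) {N : ℕ} (hN : 2 ≤ N)
    (h : 12 * ((j + 1 : ℕ) : ℝ) * Real.log N < N) :
    ((2 * ((Nat.nth Nat.Prime j - 1) * Nat.clog (Nat.nth Nat.Prime j) N) : ℕ) : ℝ) + 1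
      ≤ 12 * ((j + 1 : ℕ) : ℝ) * Real.log N := by
  set p := Nat.nth Nat.Prime j with hpdef
  have hp : 2 ≤ p := (Nat.prime_nth_prime j).two_le
  have hlogN : 0 < Real.log N := Real.log_pos (by exact_mod_cast hN)
  have hlogp : 0 < Real.log p := Real.log_pos (by exact_mod_cast hp)
  have hpN : p < N := by
    by_contra! hle
    have h1 := le_three_mul_primeCounting_mul_log hN
    have h2 : (Nat.primeCounting N : ℝ) ≤ (j + 1 : ℕ) := by
      exact_mod_cast (Nat.monotone_primeCounting hle).trans_eq (primeCounting_nth_prime j)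
    have h3 : (Nat.primeCounting N : ℝ) * Real.log N ≤ (j + 1 : ℕ) * Real.log N := by gcongr
    have h4 : (0 : ℝ) < N := by positivity
    linarith
  have hj : (p : ℝ) ≤ 3 * (((j + 1 : ℕ) : ℝ) * Real.log p) := by
    have h1 := le_three_mul_primeCounting_mul_log hp
    rwa [hpdef, primeCounting_nth_prime] at h1
  have hK1 : 1 ≤ Nat.clog p N := Nat.clog_pos (by omega) hN
  have hK : (Nat.clog p N : ℝ) * Real.log p ≤ 2 * Real.log N := by
    have h1 : p ^ (Nat.clog p N - 1) ≤ N := (Nat.pow_pred_clog_lt_self (by omega) hN).le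
    have h2 : Real.log ((p : ℝ) ^ (Nat.clog p N - 1)) ≤ Real.log N :=
      Real.log_le_log (by positivity) (by exact_mod_cast h1)
    rw [Real.log_pow, Nat.cast_sub hK1] at h2
    have h3 : Real.log p ≤ Real.log N :=
      Real.log_le_log (by positivity) (by exact_mod_cast hpN.le)
    push_cast at h2
    linarith
  have hnat : 2 * ((p - 1) * Nat.clog p N) + 1 ≤ 2 * (p * Nat.clog p N) := by
    obtain ⟨q, hq⟩ : ∃ q, p = q + 1 := ⟨p - 1, by omega⟩
    rw [hq, Nat.add_sub_cancel, add_mul, ← hq]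
    omega
  calc ((2 * ((p - 1) * Nat.clog p N) : ℕ) : ℝ) + 1 ≤ 2 * (p * Nat.clog p N) := by
        exact_mod_cast hnat
    _ ≤ 2 * (3 * (((j + 1 : ℕ) : ℝ) * Real.log p) * Nat.clog p N) := by gcongr
    _ = 6 * ((j + 1 : ℕ) : ℝ) * (Nat.clog p N * Real.log p) := by ring
    _ ≤ 6 * ((j + 1 : ℕ) : ℝ) * (2 * Real.log N) := by gcongr
    _ = 12 * ((j + 1 : ℕ) : ℝ) * Real.log N := by ring

/-- Unanchored discrepancy bound for projections of the Halton sequence: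
`D_N(H_{d,N}(u)) ≤ ((log N)^{|u|}/N) · ∏_{j∈u} 12j`. -/
theorem halton_proj_unanch_disc_bound :
    ∀ d : ℕ, 1 ≤ d → ∀ u : Finset (Fin d), u.Nonempty → ∀ N : ℕ, 2 ≤ N →
      haltonProjUnanchDisc d N u ≤
        (Real.log N) ^ u.card / N * ∏ j ∈ u, (12 * ((j.1 + 1 : ℕ) : ℝ)) := by
  intro d _ u _ N hN
  have hlogN : 0 < Real.log N := Real.log_pos (by exact_mod_cast hN)
  have hN0 : (0 : ℝ) < N := by positivity
  have hrhs : (Real.log N) ^ u.card / N * ∏ j ∈ u, (12 * ((j.1 + 1 : ℕ) : ℝ))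
      = (∏ j ∈ u, 12 * ((j.1 + 1 : ℕ) : ℝ) * Real.log N) / N := by
    rw [prod_mul_distrib (f := fun j : Fin d => 12 * ((j.1 + 1 : ℕ) : ℝ)), prod_const]
    ring
  rw [hrhs]
  have hone : ∀ j : Fin d, 1 ≤ 12 * ((j.1 + 1 : ℕ) : ℝ) * Real.log N := by
    intro j
    have h1 : Real.log 2 ≤ Real.log N := Real.log_le_log (by norm_num) (by exact_mod_cast hN)
    have h2 := Real.log_two_gt_d9
    have h3 : (1 : ℝ) ≤ ((j.1 + 1 : ℕ) : ℝ) := by simp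
    nlinarith
  refine Real.sSup_le ?_ (div_nonneg (prod_nonneg fun j _ => zero_le_one.trans (hone j)) hN0.le)
  rintro t ⟨a, b, hab, rfl⟩
  by_cases hbig : ∃ j ∈ u, (N : ℝ) ≤ 12 * ((j.1 + 1 : ℕ) : ℝ) * Real.log N
  · obtain ⟨j, hj, hjN⟩ := hbig
    have hrhs1 : 1 ≤ (∏ j ∈ u, 12 * ((j.1 + 1 : ℕ) : ℝ) * Real.log N) / N := by
      rw [le_div_iff₀ hN0, one_mul, ← mul_prod_erase u _ hj]
      have h1 : 1 ≤ ∏ i ∈ u.erase j, 12 * ((i.1 + 1 : ℕ) : ℝ) * Real.log N :=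
        one_le_prod_real fun i _ => hone i
      exact hjN.trans (le_mul_of_one_le_right (zero_le_one.trans (hone j)) h1)
    refine le_trans ?_ hrhs1
    have h0 : 0 ≤ ∏ i, (b i - a i) :=
      prod_nonneg fun i _ => sub_nonneg.2 (hab i).2.1
    have h1 : ∏ i, (b i - a i) ≤ 1 :=
      prod_le_one (fun i _ => sub_nonneg.2 (hab i).2.1) fun i _ => by
        obtain ⟨h1, h2, h3⟩ := hab i
        linarith
    rw [abs_le]
    constructor
    · refine (neg_le_neg h1).trans ?_
      rw [neg_le_sub_iff_le_add]
      exact le_add_of_nonneg_left (by positivity)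
    · refine (sub_le_self _ h0).trans ?_
      rw [div_le_one hN0]
      exact_mod_cast (card_le_univ _).trans_eq (Fintype.card_fin N)
  · push Not at hbig
    have hinj : Pairwise fun i j : u =>
        (Nat.nth Nat.Prime i.1.1).Coprime (Nat.nth Nat.Prime j.1.1) := by
      intro i j hij
      rw [Nat.coprime_primes (Nat.prime_nth_prime _) (Nat.prime_nth_prime _)]
      intro h
      exact hij (Subtype.ext (Fin.ext (Nat.nth_injective Nat.infinite_setOfPred_prime h)))
    have h := abs_card_sub_le (fun i : u => (Nat.prime_nth_prime i.1.1).one_lt) hinj hN hab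
    have hprod : ∏ i : u, (((2 * ((Nat.nth Nat.Prime i.1.1 - 1) *
          Nat.clog (Nat.nth Nat.Prime i.1.1) N) : ℕ) : ℝ) + 1)
        ≤ ∏ j ∈ u, 12 * ((j.1 + 1 : ℕ) : ℝ) * Real.log N := by
      rw [← prod_coe_sort u]
      exact prod_le_prod (fun i _ => by positivity) fun i _ =>
        clog_bound i.1.1 hN (hbig i.1 i.2)
    have hcard : ((Finset.univ.filter fun n : Fin N =>
          ∀ i : u, a i ≤ halton d n i.1 ∧ halton d n i.1 < b i).card : ℝ)
        = ∑ n ∈ range N, ∏ i : u, if a i ≤ radInv (Nat.nth Nat.Prime i.1.1) n ∧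
            radInv (Nat.nth Nat.Prime i.1.1) n < b i then (1 : ℝ) else 0 := by
      rw [← Fin.sum_univ_eq_sum_range (fun n => ∏ i : u,
        if a i ≤ radInv (Nat.nth Nat.Prime i.1.1) n ∧
          radInv (Nat.nth Nat.Prime i.1.1) n < b i then (1 : ℝ) else 0) N]
      simp only [prod_ite_zero, prod_const_one, mem_univ, forall_true_left, sum_boole]
      rfl
    rw [← hcard] at h
    rw [le_div_iff₀ hN0]
    refine le_trans (le_of_eq ?_) (h.trans hprod)
    nth_rewrite 2 [← abs_of_pos hN0]
    rw [← abs_mul]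
    congr 1
    field_simp
end
end
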